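/- arXiv:2105.07477 — 7 statements merged into one kernel-verified Lean document; each statement's English description precedes it below -/
import Mathlib

section
/- For every real number x > 0, the series ∑_{j=1}^∞ 1/(1 + j²x²) converges and equals -1/2 + (π/(2x))·coth(π/x). -/
open Real

/-- Hyperbolic cotangent. -/
noncomputable def coth (x : ℝ) : ℝ := Real.cosh x / Real.sinh x

theorem sum_one_div_one_add_sq (x : ℝ) (hx : 0 < x) :
    HasSum (fun j : ℕ => 1 / (1 + ((j : ℝ) + 1) ^ 2 * x ^ 2))
      (-1 / 2 + (π / (2 * x)) * coth (π / x)) := by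
  have hxc : (x : ℂ) ≠ 0 := by exact_mod_cast hx.ne'
  have hz : (((1 / x : ℝ) : ℂ) * Complex.I) ∈ Complex.integerComplement := by
    rintro ⟨n, hn⟩
    have h := congrArg Complex.im hn
    simp at h
    exact hx.ne' h.symm
  have hs : HasSum (fun n => cotTerm (((1 / x : ℝ) : ℂ) * Complex.I) n) _ :=
    (Summable.hasSum_iff_tendsto_nat (summable_cotTerm hz)).mpr
      (tendsto_logDeriv_euler_cot_sub hz)
  have h2 := hs.mul_left (Complex.I / (2 * x))
  rw [← Complex.hasSum_ofReal]
  have hI := Complex.I_sq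
  have hsh : Complex.sinh ((π : ℂ) / x) ≠ 0 := by
    have : Real.sinh (π / x) ≠ 0 := (Real.sinh_pos_iff.mpr (by positivity)).ne'
    have h := Complex.ofReal_ne_zero.mpr this
    push_cast at h
    exact h
  convert! h2 using 1
  · funext j
    rw [cotTerm_identity hz]
    have hd : (1 + ((j : ℂ) + 1) ^ 2 * (x : ℂ) ^ 2) ≠ 0 := by
      have : (1 + ((j : ℝ) + 1) ^ 2 * x ^ 2) ≠ 0 := by positivity
      exact_mod_cast this
    have he : ((((1 / x : ℝ) : ℂ) * Complex.I + (j + 1)) *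
        (((1 / x : ℝ) : ℂ) * Complex.I - (j + 1)))
        = -(1 + ((j : ℂ) + 1) ^ 2 * (x : ℂ) ^ 2) / (x : ℂ) ^ 2 := by
      push_cast
      field_simp
      linear_combination hI
    rw [he]
    push_cast
    field_simp
    linear_combination hI
  · have ha : (π : ℂ) * (((1 / x : ℝ) : ℂ) * Complex.I) = ((π : ℂ) / x) * Complex.I := by
      push_cast
      ring
    rw [ha, Complex.cot, Complex.cos_mul_I, Complex.sin_mul_I, coth]
    push_cast
    have hI0 := Complex.I_ne_zero
    field_simp
    ring_nf
end

section
/- For every real number x > 0, the series over odd positive integers ∑_{j odd} 1/(1 + j²x²) converges and equals (π/(4x))·tanh(π/(2x)). -/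
open Real

lemma aux_all (x : ℝ) (hx : 0 < x) :
    HasSum (fun n : ℕ => 1 / (1 + ((n : ℝ) + 1) ^ 2 * x ^ 2))
      ((π / x * (Real.cosh (π / x) / Real.sinh (π / x)) - 1) / 2) := by
  have hxc : (x : ℂ) ≠ 0 := by exact_mod_cast hx.ne'
  have hz : (Complex.I / (x : ℂ)) ∈ Complex.integerComplement := by
    rintro ⟨n, hn⟩
    have h := congrArg Complex.im hn
    have h2 : (Complex.I / (x : ℂ)).im = 1 / x := by
      simp [Complex.div_ofReal_im]
    rw [h2] at h
    simp at h
    exact hx.ne' h.symm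
  have hs := (summable_cotTerm hz).hasSum
  have hv := cot_series_rep' hz
  have hs' : HasSum (fun n : ℕ => cotTerm (Complex.I / (x : ℂ)) n)
      (π * Complex.cot (π * (Complex.I / (x : ℂ))) - 1 / (Complex.I / (x : ℂ))) := by
    rw [hv]; exact hs
  have h3 := hs'.mul_left (Complex.I / (2 * (x : ℂ)))
  rw [← Complex.hasSum_ofReal]
  have hS : Complex.sinh (π / (x : ℂ)) ≠ 0 := by
    have : Real.sinh (π / x) ≠ 0 := by
      have : 0 < Real.sinh (π / x) := Real.sinh_pos_iff.2 (by positivity)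
      exact this.ne'
    exact_mod_cast this
  convert h3 using 1
  · rfl
  · funext n
    rw [cotTerm_identity hz]
    have hd : (1 + ((n : ℂ) + 1) ^ 2 * (x : ℂ) ^ 2) ≠ 0 := by
      have : (1 + ((n : ℝ) + 1) ^ 2 * x ^ 2) ≠ 0 := by positivity
      exact_mod_cast this
    have e : (Complex.I / (x : ℂ) + (n + 1)) * (Complex.I / (x : ℂ) - (n + 1))
        = - (1 + ((n : ℂ) + 1) ^ 2 * (x : ℂ) ^ 2) / (x : ℂ) ^ 2 := by
      field_simp
      linear_combination Complex.I_sq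
    have e' : 1 / ((Complex.I / (x : ℂ) + (n + 1)) * (Complex.I / (x : ℂ) - (n + 1)))
        = - (x : ℂ) ^ 2 / (1 + ((n : ℂ) + 1) ^ 2 * (x : ℂ) ^ 2) := by
      rw [e]; field_simp
    rw [e']
    push_cast
    field_simp
    linear_combination Complex.I_sq
  · have e : (π : ℂ) * (Complex.I / (x : ℂ)) = (π / (x : ℂ)) * Complex.I := by ring
    rw [e, Complex.cot, Complex.cos_mul_I, Complex.sin_mul_I]
    push_cast
    have hI := Complex.I_ne_zero
    field_simp

theorem tanh_aux (y : ℝ) (hy : 0 < y) :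
    2 * (Real.cosh (2 * y) / Real.sinh (2 * y)) - Real.cosh y / Real.sinh y = Real.tanh y := by
  have h1 : Real.sinh y ≠ 0 := (Real.sinh_pos_iff.2 hy).ne'
  have h2 : Real.cosh y ≠ 0 := (Real.cosh_pos y).ne'
  rw [Real.tanh_eq_sinh_div_cosh, Real.cosh_two_mul, Real.sinh_two_mul]
  field_simp
  ring

/-- For every real `x > 0`, the series over odd positive integers
`∑_{j odd} 1/(1 + j²x²)` converges and equals `(π/(4x))·tanh(π/(2x))`. -/
theorem sum_odd_one_div_one_add_sq (x : ℝ) (hx : 0 < x) :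
    HasSum (fun m : ℕ => 1 / (1 + (2 * (m : ℝ) + 1) ^ 2 * x ^ 2))
      ((π / (4 * x)) * Real.tanh (π / (2 * x))) := by
  have hA := aux_all x hx
  have hE := aux_all (2 * x) (by positivity)
  have hO : Summable (fun m : ℕ => 1 / (1 + (2 * (m : ℝ) + 1) ^ 2 * x ^ 2)) := by
    have h := hA.summable.comp_injective (i := fun m : ℕ => 2 * m)
      (fun a b h => by simpa using h)
    refine h.congr fun m => ?_
    simp
  have hE' : HasSum (fun m : ℕ => 1 / (1 + (((2 * m + 1 : ℕ) : ℝ) + 1) ^ 2 * x ^ 2))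
      ((π / (2 * x) * (Real.cosh (π / (2 * x)) / Real.sinh (π / (2 * x))) - 1) / 2) := by
    convert hE using 3 with m
    push_cast
    ring
  have hO' : HasSum (fun m : ℕ => 1 / (1 + (((2 * m : ℕ) : ℝ) + 1) ^ 2 * x ^ 2))
      (∑' m : ℕ, 1 / (1 + (2 * (m : ℝ) + 1) ^ 2 * x ^ 2)) := by
    simpa using hO.hasSum
  have hT := HasSum.even_add_odd
    (f := fun n : ℕ => 1 / (1 + ((n : ℝ) + 1) ^ 2 * x ^ 2)) hO' hE'
  have hq := hT.unique hA
  have ht := tanh_aux (π / (2 * x)) (by positivity)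
  have h2 : 2 * (π / (2 * x)) = π / x := by field_simp
  rw [h2] at ht
  convert hO.hasSum using 1
  rw [← ht]
  have h4 : π / (4 * x) = π / x / 4 := by field_simp
  have h5 : π / (2 * x) = π / x / 2 := by field_simp
  rw [h4]
  rw [h5] at hq ⊢
  linear_combination -hq
end

section
/- For all real numbers L > 0 and H > 0, the double series over odd positive integers j, k of 1/( j²k² ( (j/L)² + (k/H)² ) ) converges and equals H²·( π⁶/768 − (πH/(4L))·∑_{k odd} (1/k⁵)·tanh(kπL/(2H)) ), where the remaining sum runs over odd positive integers k. -/
open Real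

lemma aux_congr {f g : ℕ → ℝ} {a b : ℝ} (h : HasSum f a) (hfg : ∀ n, g n = f n) (hab : b = a) :
    HasSum g b := by
  rw [hab, funext hfg]; exact h

lemma aux_coth (b : ℝ) (hb : 0 < b) :
    HasSum (fun n : ℕ => 1 / ((n : ℝ) ^ 2 + b ^ 2))
      ((π * (Real.cosh (π * b) / Real.sinh (π * b)) + 1 / b) / (2 * b)) := by
  have hz : ((b : ℂ) * Complex.I) ∈ Complex.integerComplement :=
    UpperHalfPlane.coe_mem_integerComplement ⟨(b : ℂ) * Complex.I, by simpa using hb⟩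
  have hs : Summable fun n : ℕ => (1 / ((b : ℂ) * Complex.I - (n + 1)) + 1 / ((b : ℂ) * Complex.I + (n + 1))) :=
    summable_cotTerm hz
  have h := hs.hasSum
  rw [← cot_series_rep' hz] at h
  have h2 := h.mul_left (Complex.I / (2 * b))
  have hb' : (b : ℂ) ≠ 0 := by exact_mod_cast hb.ne'
  have hsh : Real.sinh (π * b) ≠ 0 := by
    rw [Ne, Real.sinh_eq_zero]; positivity
  have e1 : (fun n : ℕ => Complex.I / (2 * b) * (1 / ((b : ℂ) * Complex.I - (n + 1)) + 1 / ((b : ℂ) * Complex.I + (n + 1))))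
      = fun n : ℕ => ((1 / (((n + 1 : ℕ) : ℝ) ^ 2 + b ^ 2) : ℝ) : ℂ) := by
    funext n
    have n1 : (b : ℂ) * Complex.I - (n + 1) ≠ 0 := by
      intro h0
      have := congrArg Complex.im h0
      simp at this; exact hb.ne' this
    have n2 : (b : ℂ) * Complex.I + (n + 1) ≠ 0 := by
      intro h0
      have := congrArg Complex.im h0
      simp at this; exact hb.ne' this
    have n3 : ((n : ℂ) + 1) ^ 2 + (b : ℂ) ^ 2 ≠ 0 := by
      have : ((n : ℝ) + 1) ^ 2 + b ^ 2 ≠ 0 := by positivity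
      exact_mod_cast this
    push_cast
    have n4 : ((b : ℂ) * Complex.I - (n + 1)) * ((b : ℂ) * Complex.I + (n + 1)) =
       - (((n : ℂ) + 1) ^ 2 + (b : ℂ) ^ 2) := by
      linear_combination (b : ℂ) ^ 2 * Complex.I_sq
    rw [div_add_div _ _ n1 n2, n4]
    field_simp
    linear_combination (-2 * (b : ℂ)) * Complex.I_sq
  have e2 : Complex.I / (2 * b) * ((π : ℂ) * Complex.cot (π * (b * Complex.I)) - 1 / (b * Complex.I))
      = (((π * (Real.cosh (π * b) / Real.sinh (π * b)) - 1 / b) / (2 * b) : ℝ) : ℂ) := by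
    rw [Complex.cot_eq_cos_div_sin, ← mul_assoc, Complex.cos_mul_I, Complex.sin_mul_I]
    have hsh' : Complex.sinh (π * b) ≠ 0 := by exact_mod_cast hsh
    push_cast
    field_simp
  rw [e1, e2, Complex.hasSum_ofReal] at h2
  have h3 := (hasSum_nat_add_iff (f := fun n : ℕ => 1 / ((n : ℝ) ^ 2 + b ^ 2)) 1).1 h2
  refine aux_congr h3 (fun n => rfl) ?_
  simp
  field_simp
  ring

lemma aux_tanh (a : ℝ) (ha : 0 < a) :
    HasSum (fun n : ℕ => 1 / ((2 * (n : ℝ) + 1) ^ 2 + a ^ 2))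
      (π / (4 * a) * Real.tanh (π * a / 2)) := by
  have h1 := aux_coth a ha
  have h2 := (aux_coth (a / 2) (by positivity)).mul_left (1 / 4)
  have hev : HasSum (fun n : ℕ => 1 / (((2 * n : ℕ) : ℝ) ^ 2 + a ^ 2))
      (1 / 4 * ((π * (Real.cosh (π * (a / 2)) / Real.sinh (π * (a / 2))) + 1 / (a / 2)) / (2 * (a / 2)))) := by
    refine aux_congr h2 (fun n => ?_) rfl
    push_cast
    field_simp
    ring
  have hod : Summable (fun n : ℕ => 1 / (((2 * n + 1 : ℕ) : ℝ) ^ 2 + a ^ 2)) :=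
    h1.summable.comp_injective (i := fun n : ℕ => 2 * n + 1) (fun x y h => by simpa using h)
  have hh := HasSum.even_add_odd (f := fun n : ℕ => 1 / ((n : ℝ) ^ 2 + a ^ 2)) hev hod.hasSum
  have key := hh.unique h1
  have := hod.hasSum
  push_cast at this key
  refine aux_congr this (fun n => rfl) ?_
  rw [← eq_sub_iff_add_eq'] at key
  rw [key]
  have hx : π * a = 2 * (π * (a / 2)) := by ring
  have hx2 : π * a / 2 = π * (a / 2) := by ring
  rw [hx2, hx, Real.cosh_two_mul, Real.sinh_two_mul, Real.tanh_eq_sinh_div_cosh]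
  have hsh : Real.sinh (π * (a / 2)) ≠ 0 := by
    rw [Ne, Real.sinh_eq_zero]; positivity
  have hch : Real.cosh (π * (a / 2)) ≠ 0 := (Real.cosh_pos _).ne'
  field_simp
  ring

lemma aux_odd (k : ℕ) (hk : k ≠ 0) (S : ℝ) (h : HasSum (fun n : ℕ => (1 : ℝ) / (n : ℝ) ^ k) S) :
    HasSum (fun n : ℕ => 1 / (2 * (n : ℝ) + 1) ^ k) ((1 - 1 / 2 ^ k) * S) := by
  have hev : HasSum (fun n : ℕ => 1 / ((2 * n : ℕ) : ℝ) ^ k) (1 / 2 ^ k * S) := by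
    refine aux_congr (h.mul_left (1 / 2 ^ k)) (fun n => ?_) rfl
    push_cast
    rw [mul_pow, one_div_mul_one_div]
  have hod : Summable (fun n : ℕ => 1 / ((2 * n + 1 : ℕ) : ℝ) ^ k) :=
    h.summable.comp_injective (i := fun n : ℕ => 2 * n + 1) (fun x y h => by simpa using h)
  have key := (HasSum.even_add_odd (f := fun n : ℕ => 1 / (n : ℝ) ^ k) hev hod.hasSum).unique h
  have := hod.hasSum
  push_cast at this key
  refine aux_congr this (fun n => rfl) ?_
  linarith

/-- For all `L > 0`, `H > 0`, the double series over odd positive integers `j = 2m+1`,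
`k = 2n+1` of `1/(j²k²((j/L)² + (k/H)²))` converges and equals
`H²·(π⁶/768 − (πH/(4L))·∑_{k odd} (1/k⁵)·tanh(kπL/(2H)))`. -/
theorem double_sum_odd_rectangle (L H : ℝ) (hL : 0 < L) (hH : 0 < H) :
    HasSum
      (fun p : ℕ × ℕ =>
        1 / ((2 * (p.1 : ℝ) + 1) ^ 2 * (2 * (p.2 : ℝ) + 1) ^ 2 *
          (((2 * (p.1 : ℝ) + 1) / L) ^ 2 + ((2 * (p.2 : ℝ) + 1) / H) ^ 2)))
      (H ^ 2 * (π ^ 6 / 768 -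
        (π * H / (4 * L)) *
          ∑' n : ℕ, (1 / (2 * (n : ℝ) + 1) ^ 5) *
            Real.tanh ((2 * (n : ℝ) + 1) * π * L / (2 * H)))) := by
  have hrow : ∀ n : ℕ, HasSum (fun m : ℕ => 1 / ((2 * (m : ℝ) + 1) ^ 2 * (2 * (n : ℝ) + 1) ^ 2 *
          (((2 * (m : ℝ) + 1) / L) ^ 2 + ((2 * (n : ℝ) + 1) / H) ^ 2)))
      (H ^ 2 * (π ^ 2 / 8 * (1 / (2 * (n : ℝ) + 1) ^ 4) - (π * H / (4 * L)) * ((1 / (2 * (n : ℝ) + 1) ^ 5) *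
            Real.tanh ((2 * (n : ℝ) + 1) * π * L / (2 * H))))) := by
    intro n
    have hk : 0 < 2 * (n : ℝ) + 1 := by positivity
    have h1 := aux_odd 2 (by norm_num) _ hasSum_zeta_two
    have h2 := aux_tanh ((2 * (n : ℝ) + 1) * L / H) (by positivity)
    have h3 := (h1.sub h2).mul_left (H ^ 2 / (2 * (n : ℝ) + 1) ^ 4)
    refine aux_congr h3 (fun m => ?_) ?_
    · have hj : 0 < 2 * (m : ℝ) + 1 := by positivity
      generalize 2 * (m : ℝ) + 1 = j at *
      generalize 2 * (n : ℝ) + 1 = k at *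
      field_simp
      ring
    · have : π * ((2 * (n : ℝ) + 1) * L / H) / 2 = (2 * (n : ℝ) + 1) * π * L / (2 * H) := by
        field_simp
      rw [this]
      generalize Real.tanh _ = t
      generalize 2 * (n : ℝ) + 1 = k at *
      field_simp
      ring
  have h4 := aux_odd 4 (by norm_num) _ hasSum_zeta_four
  have h5 : Summable fun n : ℕ => (1 / (2 * (n : ℝ) + 1) ^ 5) *
            Real.tanh ((2 * (n : ℝ) + 1) * π * L / (2 * H)) := by
    refine Summable.of_norm_bounded h4.summable (fun n => ?_)
    rw [norm_mul, Real.norm_eq_abs, Real.norm_eq_abs]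
    have ht : |Real.tanh ((2 * (n : ℝ) + 1) * π * L / (2 * H))| ≤ 1 := (Real.abs_tanh_lt_one _).le
    have hp : |1 / (2 * (n : ℝ) + 1) ^ 5| ≤ 1 / (2 * (n : ℝ) + 1) ^ 4 := by
      rw [abs_of_pos (by positivity)]
      apply one_div_le_one_div_of_le (by positivity)
      apply pow_le_pow_right₀ _ (by norm_num)
      have : (0 : ℝ) ≤ n := by positivity
      linarith
    calc _ ≤ 1 / (2 * (n : ℝ) + 1) ^ 4 * 1 := mul_le_mul hp ht (abs_nonneg _) (by positivity)
      _ = _ := mul_one _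
  have hcol := ((h4.mul_left (π ^ 2 / 8)).sub (h5.hasSum.mul_left (π * H / (4 * L)))).mul_left (H ^ 2)
  have hval : π ^ 2 / 8 * ((1 - 1 / 2 ^ 4) * (π ^ 4 / 90)) = π ^ 6 / 768 := by ring
  rw [hval] at hcol
  rw [← (Equiv.prodComm ℕ ℕ).hasSum_iff]
  have hsum : Summable ((fun p : ℕ × ℕ =>
        1 / ((2 * (p.1 : ℝ) + 1) ^ 2 * (2 * (p.2 : ℝ) + 1) ^ 2 *
          (((2 * (p.1 : ℝ) + 1) / L) ^ 2 + ((2 * (p.2 : ℝ) + 1) / H) ^ 2))) ∘ (Equiv.prodComm ℕ ℕ)) := by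
    rw [summable_prod_of_nonneg]
    · refine ⟨fun n => (hrow n).summable, ?_⟩
      refine hcol.summable.congr (fun n => ?_)
      exact (hrow n).tsum_eq.symm
    · intro p
      simp only [Function.comp, Pi.zero_apply]
      positivity
  have hfin := hsum.hasSum.prod_fiberwise (fun n => hrow n)
  rw [← hfin.unique hcol]
  exact hsum.hasSum
end

section
/- Let L > 0, H > 0 and let Ω = (0,L) × (0,H) ⊂ ℝ². Suppose u : ℝ² → ℝ is continuous on the closure of Ω, twice continuously differentiable on Ω, satisfies ∂²u/∂x² + ∂²u/∂y² = −1 at every point of Ω, and u = 0 at every point of the boundary of Ω. Then ∫_Ω u(x,y) dx dy = (4³ H³ L / π⁶) · ( Z_r − (1/4)·(πH/L)·∑_{k odd} (1/k⁵)·tanh( kπL/(2H) ) ), where Z_r = (1/12)·π⁶/2⁶ and the sum runs over odd positive integers k. -/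
open Real MeasureTheory Filter Topology

lemma dd_eq (f : ℝ → ℝ) (x : ℝ) : deriv (fun t => deriv f t) x = iteratedDeriv 2 f x := by
  rw [iteratedDeriv_succ, iteratedDeriv_one]

lemma dd_add {f g : ℝ → ℝ} {x : ℝ} (hf : ContDiffAt ℝ 2 f x) (hg : ContDiffAt ℝ 2 g x) :
    deriv (fun t => deriv (fun s => f s + g s) t) x =
      deriv (fun t => deriv f t) x + deriv (fun t => deriv g t) x := by
  simp only [dd_eq]
  exact iteratedDeriv_add hf hg

lemma dd_nonpos {f : ℝ → ℝ} {x : ℝ} (hc : ContinuousAt f x) (h : IsLocalMax f x) :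
    deriv (fun t => deriv f t) x ≤ 0 := by
  by_contra! hp
  have hmin := isLocalMin_of_deriv_deriv_pos (f := f) hp h.deriv_eq_zero hc
  have he : f =ᶠ[𝓝 x] fun _ => f x := by
    filter_upwards [h, hmin] with y h1 h2
    exact le_antisymm h1 h2
  have h2 : deriv f =ᶠ[𝓝 x] deriv fun _ => f x := he.deriv
  have h3 := h2.deriv_eq
  have : deriv (deriv f) x = 0 := by rw [h3]; simp
  exact absurd hp (by change ¬ 0 < deriv (deriv f) x; rw [this]; simp)

lemma sliceX {v : ℝ × ℝ → ℝ} {p : ℝ × ℝ} (h : ContDiffAt ℝ 2 v p) :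
    ContDiffAt ℝ 2 (fun x => v (x, p.2)) p.1 :=
  ContDiffAt.comp (g := v) (f := fun x : ℝ => (x, p.2)) p.1 h (by fun_prop)

lemma sliceY {v : ℝ × ℝ → ℝ} {p : ℝ × ℝ} (h : ContDiffAt ℝ 2 v p) :
    ContDiffAt ℝ 2 (fun y => v (p.1, y)) p.2 :=
  ContDiffAt.comp (g := v) (f := fun y : ℝ => (p.1, y)) p.2 h (by fun_prop)

lemma max_principle (L H : ℝ) (hL : 0 < L) (hH : 0 < H) (v : ℝ × ℝ → ℝ) (ε : ℝ)
    (hc : ContinuousOn v (Set.Icc 0 L ×ˢ Set.Icc 0 H))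
    (hd : ∀ p ∈ Set.Ioo (0 : ℝ) L ×ˢ Set.Ioo (0 : ℝ) H, ContDiffAt ℝ 2 v p)
    (hp : ∀ p ∈ Set.Ioo (0 : ℝ) L ×ˢ Set.Ioo (0 : ℝ) H,
      deriv (fun x : ℝ => deriv (fun x' : ℝ => v (x', p.2)) x) p.1 +
        deriv (fun y : ℝ => deriv (fun y' : ℝ => v (p.1, y')) y) p.2 = 0)
    (hb : ∀ p ∈ Set.Icc (0 : ℝ) L ×ˢ Set.Icc (0 : ℝ) H,
      p ∉ Set.Ioo (0 : ℝ) L ×ˢ Set.Ioo (0 : ℝ) H → v p ≤ ε)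
    (p : ℝ × ℝ) (hpm : p ∈ Set.Icc (0 : ℝ) L ×ˢ Set.Icc (0 : ℝ) H) : v p ≤ ε := by
  refine le_of_forall_pos_le_add fun η hη => ?_
  set δ := η / L ^ 2 with hδ
  have hδp : 0 < δ := by positivity
  have hδL : δ * L ^ 2 = η := by rw [hδ]; field_simp
  set g : ℝ × ℝ → ℝ := fun q => v q + δ * q.1 ^ 2 with hg
  have hgc : ContinuousOn g (Set.Icc 0 L ×ˢ Set.Icc 0 H) := hc.add (by fun_prop)
  obtain ⟨q, hq, hmax⟩ := (isCompact_Icc.prod isCompact_Icc).exists_isMaxOn ⟨p, hpm⟩ hgc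
  have hqb : q ∉ Set.Ioo (0 : ℝ) L ×ˢ Set.Ioo (0 : ℝ) H := by
    intro hqi
    have hnhd : Set.Icc (0 : ℝ) L ×ˢ Set.Icc (0 : ℝ) H ∈ 𝓝 q := by
      refine Filter.mem_of_superset ((isOpen_Ioo.prod isOpen_Ioo).mem_nhds hqi) ?_
      exact Set.prod_mono Set.Ioo_subset_Icc_self Set.Ioo_subset_Icc_self
    have hlm : IsLocalMax g q := hmax.isLocalMax hnhd
    have hvq := hd q hqi
    have hgq : ContinuousAt g q := hgc.continuousAt hnhd
    have cx : ContinuousAt (fun x : ℝ => (x, q.2)) q.1 := by fun_prop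
    have cy : ContinuousAt (fun y : ℝ => (q.1, y)) q.2 := by fun_prop
    have h1 := dd_nonpos (f := fun x => g (x, q.2)) (x := q.1)
      (ContinuousAt.comp (g := g) hgq cx) (cx.eventually (p := fun z => g z ≤ g q) hlm)
    have h2 := dd_nonpos (f := fun y => g (q.1, y)) (x := q.2)
      (ContinuousAt.comp (g := g) hgq cy) (cy.eventually (p := fun z => g z ≤ g q) hlm)
    have e1 := dd_add (f := fun x => v (x, q.2)) (g := fun x => δ * x ^ 2) (x := q.1)
      (sliceX hvq) (by fun_prop)
    have e2 := dd_add (f := fun y => v (q.1, y)) (g := fun y => δ * q.1 ^ 2) (x := q.2)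
      (sliceY hvq) (by fun_prop)
    have e3 : deriv (fun t => deriv (fun x : ℝ => δ * x ^ 2) t) q.1 = 2 * δ := by
      have : (fun t => deriv (fun x : ℝ => δ * x ^ 2) t) = fun t => (2 * δ) * t := by
        funext t; simp; ring
      rw [this]; simp
    have e4 : deriv (fun t => deriv (fun y : ℝ => δ * q.1 ^ 2) t) q.2 = 0 := by simp
    have := hp q hqi
    simp only [hg] at h1 h2
    linarith
  have h1 := hb q hq hqb
  have h2 : g p ≤ g q := hmax hpm
  have h3 : q.1 ^ 2 ≤ L ^ 2 := by
    have := hq.1.1; have := hq.1.2; gcongr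
  have h4 : 0 ≤ δ * p.1 ^ 2 := by positivity
  have h5 : δ * q.1 ^ 2 ≤ δ * L ^ 2 := by gcongr
  simp only [hg] at h2
  linarith

lemma fourier_odd (x : ℝ) (h0 : 0 ≤ x) (h1 : x ≤ 1 / 2) :
    HasSum (fun k : ℕ => 1 / (2 * (k : ℝ) + 1) ^ 3 * Real.sin (2 * π * (2 * (k : ℝ) + 1) * x))
      (π ^ 3 * (x / 4 - x ^ 2 / 2)) := by
  have hB : ∀ x : ℝ, (Polynomial.map (algebraMap ℚ ℝ) (Polynomial.bernoulli 3)).eval x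
      = x ^ 3 - 3 / 2 * x ^ 2 + x / 2 := by
    intro x
    simp [Polynomial.bernoulli, Finset.sum_range_succ, bernoulli_eq_bernoulli'_of_ne_one, Polynomial.eval_add, Nat.choose]
    ring
  have a1 := hasSum_one_div_nat_pow_mul_sin (k := 1) one_ne_zero (x := x) ⟨h0, by linarith⟩
  have a2 := hasSum_one_div_nat_pow_mul_sin (k := 1) one_ne_zero (x := 2 * x)
    ⟨by linarith, by linarith⟩
  simp only [Nat.reduceMul, Nat.reduceAdd, hB] at a1 a2
  set F : ℕ → ℝ := fun n : ℕ => 1 / (n : ℝ) ^ 3 * Real.sin (2 * π * n * x) with hF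
  have hs := a2.mul_left (1 / 8)
  have he : (fun n : ℕ => 1 / 8 * (1 / (n : ℝ) ^ 3 * Real.sin (2 * π * n * (2 * x)))) =
      fun k => F (2 * k) := by
    funext n
    simp only [hF]
    push_cast
    rw [show 2 * π * (2 * (n : ℝ)) * x = 2 * π * n * (2 * x) by ring, mul_pow, one_div_mul_eq_div,
      one_div, one_div, mul_inv]
    ring
  rw [he] at hs
  have ho : Summable (fun k => F (2 * k + 1)) :=
    a1.summable.comp_injective (i := fun k : ℕ => 2 * k + 1) (fun a b h => by simpa using h)
  have hu := (hs.even_add_odd ho.hasSum).unique a1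
  have hfin := ho.hasSum
  have e : ∑' k, F (2 * k + 1) = π ^ 3 * (x / 4 - x ^ 2 / 2) := by
    norm_num [Nat.factorial] at hu
    linear_combination hu
  rw [e] at hfin
  simpa [hF] using hfin

lemma fourier_H (H : ℝ) (hH : 0 < H) (y : ℝ) (h0 : 0 ≤ y) (h1 : y ≤ H) :
    HasSum (fun k : ℕ => 4 / (H * ((2 * (k : ℝ) + 1) * π / H) ^ 3) *
      Real.sin ((2 * (k : ℝ) + 1) * π / H * y)) (y * (H - y) / 2) := by
  have h := (fourier_odd (y / (2 * H)) (by positivity)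
    (by rw [div_le_div_iff₀ (by positivity) (by positivity)]; linarith)).mul_left (4 * H ^ 2 / π ^ 3)
  have e1 : (fun k : ℕ => 4 / (H * ((2 * (k : ℝ) + 1) * π / H) ^ 3) *
      Real.sin ((2 * (k : ℝ) + 1) * π / H * y)) = fun k : ℕ => 4 * H ^ 2 / π ^ 3 *
      (1 / (2 * (k : ℝ) + 1) ^ 3 * Real.sin (2 * π * (2 * (k : ℝ) + 1) * (y / (2 * H)))) := by
    funext k
    have : 2 * π * (2 * (k : ℝ) + 1) * (y / (2 * H)) = (2 * (k : ℝ) + 1) * π / H * y := by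
      field_simp
    rw [this]
    have : (2 * (k : ℝ) + 1) ≠ 0 := by positivity
    field_simp
  have e2 : y * (H - y) / 2 =
      4 * H ^ 2 / π ^ 3 * (π ^ 3 * (y / (2 * H) / 4 - (y / (2 * H)) ^ 2 / 2)) := by
    field_simp
    ring
  rw [e1, e2]
  exact h

/-- frequencies -/
noncomputable def fr (H : ℝ) (k : ℕ) : ℝ := (2 * (k : ℝ) + 1) * π / H

/-- coefficients -/
noncomputable def cf (L H : ℝ) (k : ℕ) : ℝ := 4 / (H * fr H k ^ 3) / Real.cosh (fr H k * (L / 2))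

/-- approximate solutions -/
noncomputable def wN (L H : ℝ) (N : ℕ) (p : ℝ × ℝ) : ℝ :=
  p.2 * (H - p.2) / 2 - ∑ k ∈ Finset.range N,
    cf L H k * (Real.cosh (fr H k * (p.1 - L / 2)) * Real.sin (fr H k * p.2))

lemma fr_pos {H : ℝ} (hH : 0 < H) (k : ℕ) : 0 < fr H k := by unfold fr; positivity

lemma wN_contDiff (L H : ℝ) (N : ℕ) : ContDiff ℝ 2 (wN L H N) := by
  unfold wN
  have : ∀ k : ℕ, ContDiff ℝ 2 (fun p : ℝ × ℝ => Real.cosh (fr H k * (p.1 - L / 2))) := fun k =>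
    Real.contDiff_cosh.comp (by fun_prop)
  fun_prop

lemma wN_xx (L H : ℝ) (N : ℕ) (p : ℝ × ℝ) :
    deriv (fun x : ℝ => deriv (fun x' : ℝ => wN L H N (x', p.2)) x) p.1 =
      - ∑ k ∈ Finset.range N,
    cf L H k * (fr H k ^ 2 * Real.cosh (fr H k * (p.1 - L / 2)) * Real.sin (fr H k * p.2)) := by
  have hl : ∀ (k : ℕ) (x : ℝ), HasDerivAt (fun x => fr H k * (x - L / 2)) (fr H k) x := fun k x => by
    simpa using ((hasDerivAt_id x).sub_const (L / 2)).const_mul (fr H k)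
  have h1 : (fun x : ℝ => deriv (fun x' : ℝ => wN L H N (x', p.2)) x) = fun x =>
      0 - ∑ k ∈ Finset.range N,
        cf L H k * (Real.sinh (fr H k * (x - L / 2)) * fr H k * Real.sin (fr H k * p.2)) := by
    funext x
    refine HasDerivAt.deriv ?_
    unfold wN
    refine HasDerivAt.sub (hasDerivAt_const x (p.2 * (H - p.2) / 2)) (HasDerivAt.fun_sum fun k _ => ?_)
    exact ((hl k x).cosh.mul_const (Real.sin (fr H k * p.2))).const_mul (cf L H k)
  rw [h1]
  refine HasDerivAt.deriv ?_
  rw [← zero_sub]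
  refine HasDerivAt.sub (hasDerivAt_const _ _) (HasDerivAt.fun_sum fun k _ => ?_)
  refine HasDerivAt.congr_deriv ((((hl k p.1).sinh.mul_const (fr H k)).mul_const
    (Real.sin (fr H k * p.2))).const_mul (cf L H k)) ?_
  ring

lemma wN_yy (L H : ℝ) (N : ℕ) (p : ℝ × ℝ) :
    deriv (fun y : ℝ => deriv (fun y' : ℝ => wN L H N (p.1, y')) y) p.2 =
      -1 + ∑ k ∈ Finset.range N,
    cf L H k * (fr H k ^ 2 * Real.cosh (fr H k * (p.1 - L / 2)) * Real.sin (fr H k * p.2)) := by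
  have hl : ∀ (k : ℕ) (x : ℝ), HasDerivAt (fun x => fr H k * x) (fr H k) x := fun k x => by
    simpa using (hasDerivAt_id x).const_mul (fr H k)
  have h1 : (fun y : ℝ => deriv (fun y' : ℝ => wN L H N (p.1, y')) y) = fun y =>
      (H / 2 - y) - ∑ k ∈ Finset.range N,
        cf L H k * (Real.cosh (fr H k * (p.1 - L / 2)) * (Real.cos (fr H k * y) * fr H k)) := by
    funext y
    refine HasDerivAt.deriv ?_
    unfold wN
    refine HasDerivAt.sub ?_ (HasDerivAt.fun_sum fun k _ => ?_)
    · have := (((hasDerivAt_id y).mul ((hasDerivAt_id y).const_sub H))).div_const 2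
      refine HasDerivAt.congr_deriv this ?_
      simp only [id]
      ring
    · exact ((hl k y).sin.const_mul (Real.cosh (fr H k * (p.1 - L / 2)))).const_mul (cf L H k)
  rw [h1]
  refine HasDerivAt.deriv ?_
  rw [← sub_neg_eq_add, ← Finset.sum_neg_distrib]
  refine HasDerivAt.sub ?_ (HasDerivAt.fun_sum fun k _ => ?_)
  · exact (hasDerivAt_id p.2).const_sub (H / 2)
  · refine HasDerivAt.congr_deriv ((((hl k p.2).cos.mul_const (fr H k)).const_mul (Real.cosh (fr H k * (p.1 - L / 2)))).const_mul (cf L H k)) ?_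
    ring

lemma sin_frH {H : ℝ} (hH : 0 < H) (k : ℕ) : Real.sin (fr H k * H) = 0 := by
  have : fr H k * H = ((2 * k + 1 : ℕ) : ℝ) * π := by unfold fr; push_cast; field_simp
  rw [this, Real.sin_nat_mul_pi]

lemma cos_frH {H : ℝ} (hH : 0 < H) (k : ℕ) : Real.cos (fr H k * H) = -1 := by
  have : fr H k * H = (k : ℝ) * (2 * π) + π := by unfold fr; field_simp
  rw [this, Real.cos_nat_mul_two_pi_add_pi]

lemma wN_y0 (L H : ℝ) (N : ℕ) (x : ℝ) : wN L H N (x, 0) = 0 := by simp [wN]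

lemma wN_yH (L H : ℝ) (hH : 0 < H) (N : ℕ) (x : ℝ) : wN L H N (x, H) = 0 := by
  simp [wN, sin_frH hH]

lemma cf_cosh (L H : ℝ) (k : ℕ) : cf L H k * Real.cosh (fr H k * (L / 2)) = 4 / (H * fr H k ^ 3) := by
  unfold cf
  have := (Real.cosh_pos (fr H k * (L / 2))).ne'
  field_simp

lemma wN_xL (L H : ℝ) (N : ℕ) (y : ℝ) : wN L H N (L, y) =
    y * (H - y) / 2 - ∑ k ∈ Finset.range N, 4 / (H * fr H k ^ 3) * Real.sin (fr H k * y) := by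
  simp only [wN]
  congr 1
  refine Finset.sum_congr rfl fun k _ => ?_
  rw [← cf_cosh L, show L - L / 2 = L / 2 by ring]; ring

lemma wN_x0 (L H : ℝ) (N : ℕ) (y : ℝ) : wN L H N (0, y) =
    y * (H - y) / 2 - ∑ k ∈ Finset.range N, 4 / (H * fr H k ^ 3) * Real.sin (fr H k * y) := by
  simp only [wN]
  congr 1
  refine Finset.sum_congr rfl fun k _ => ?_
  rw [← cf_cosh L, show fr H k * (0 - L / 2) = - (fr H k * (L / 2)) by ring, Real.cosh_neg]; ring

lemma summable_odd (m : ℕ) (hm : 1 < m) : Summable fun k : ℕ => 1 / (2 * (k : ℝ) + 1) ^ m := by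
  have := (Real.summable_one_div_nat_pow.2 hm).comp_injective (i := fun k : ℕ => 2 * k + 1)
    (fun a b h => by simpa using h)
  refine this.congr fun k => ?_
  simp

lemma bd_unif (H : ℝ) (hH : 0 < H) (ε : ℝ) (hε : 0 < ε) : ∀ᶠ N in atTop, ∀ y ∈ Set.Icc 0 H,
    |y * (H - y) / 2 - ∑ k ∈ Finset.range N, 4 / (H * fr H k ^ 3) * Real.sin (fr H k * y)| < ε := by
  have hs : Summable fun k : ℕ => 4 / (H * fr H k ^ 3) := by
    refine ((summable_odd 3 (by norm_num)).mul_left (4 * H ^ 2 / π ^ 3)).congr fun k => ?_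
    unfold fr
    have : (2 * (k : ℝ) + 1) ≠ 0 := by positivity
    field_simp
  have := tendstoUniformlyOn_tsum_nat (s := Set.Icc 0 H)
    (f := fun k y => 4 / (H * fr H k ^ 3) * Real.sin (fr H k * y)) hs (by
      intro k y _
      have := fr_pos hH k
      rw [norm_mul, Real.norm_of_nonneg (by positivity)]
      exact mul_le_of_le_one_right (by positivity) (Real.abs_sin_le_one _))
  rw [Metric.tendstoUniformlyOn_iff] at this
  filter_upwards [this ε hε] with N hN y hy
  have h := hN y hy
  have hf : ∑' k : ℕ, 4 / (H * fr H k ^ 3) * Real.sin (fr H k * y) = y * (H - y) / 2 :=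
    (fourier_H H hH y hy.1 hy.2).tsum_eq
  rw [hf, Real.dist_eq] at h
  exact h

lemma int_sin {H : ℝ} (hH : 0 < H) (k : ℕ) :
    ∫ y in Set.Ioo 0 H, Real.sin (fr H k * y) = 2 / fr H k := by
  have := (fr_pos hH k).ne'
  rw [← integral_Ioc_eq_integral_Ioo, ← intervalIntegral.integral_of_le hH.le,
    intervalIntegral.integral_comp_mul_left (fun y => Real.sin y) this, integral_sin, cos_frH hH]
  simp; field_simp; norm_num

lemma int_cosh {L H : ℝ} (hL : 0 < L) (hH : 0 < H) (k : ℕ) :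
    ∫ x in Set.Ioo 0 L, Real.cosh (fr H k * (x - L / 2)) =
      2 * Real.sinh (fr H k * (L / 2)) / fr H k := by
  have h0 := (fr_pos hH k).ne'
  rw [← integral_Ioc_eq_integral_Ioo, ← intervalIntegral.integral_of_le hL.le]
  have hd : ∀ x ∈ Set.uIcc 0 L, HasDerivAt (fun x => Real.sinh (fr H k * (x - L / 2)) / fr H k)
      (Real.cosh (fr H k * (x - L / 2))) x := by
    intro x _
    have h1 : HasDerivAt (fun x => fr H k * (x - L / 2)) (fr H k) x := by
      simpa using ((hasDerivAt_id x).sub_const (L / 2)).const_mul (fr H k)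
    refine (h1.sinh.div_const (fr H k)).congr_deriv ?_
    field_simp
  rw [intervalIntegral.integral_eq_sub_of_hasDerivAt hd
    (Continuous.intervalIntegrable (Real.continuous_cosh.comp (by fun_prop)) _ _)]
  rw [show fr H k * (0 - L / 2) = - (fr H k * (L / 2)) by ring, Real.sinh_neg,
    show L - L / 2 = L / 2 by ring]
  ring

lemma int_poly {H : ℝ} (hH : 0 < H) : ∫ y in Set.Ioo 0 H, y * (H - y) / 2 = H ^ 3 / 12 := by
  rw [← integral_Ioc_eq_integral_Ioo, ← intervalIntegral.integral_of_le hH.le]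
  have hd : ∀ x ∈ Set.uIcc 0 H, HasDerivAt (fun x => H * x ^ 2 / 4 - x ^ 3 / 6)
      (x * (H - x) / 2) x := by
    intro x _
    refine ((((hasDerivAt_pow 2 x).const_mul H).div_const 4).sub
      ((hasDerivAt_pow 3 x).div_const 6)).congr_deriv ?_
    push_cast
    ring
  rw [intervalIntegral.integral_eq_sub_of_hasDerivAt hd
    (Continuous.intervalIntegrable (by fun_prop) _ _)]
  ring

lemma integrableOn_rect {L H : ℝ} {f : ℝ × ℝ → ℝ}
    (hf : ContinuousOn f (Set.Icc 0 L ×ˢ Set.Icc 0 H)) :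
    IntegrableOn f (Set.Ioo 0 L ×ˢ Set.Ioo 0 H) :=
  (hf.integrableOn_compact (isCompact_Icc.prod isCompact_Icc)).mono_set
    (Set.prod_mono Set.Ioo_subset_Icc_self Set.Ioo_subset_Icc_self)

lemma int_wN {L H : ℝ} (hL : 0 < L) (hH : 0 < H) (N : ℕ) :
    ∫ p in Set.Ioo 0 L ×ˢ Set.Ioo 0 H, wN L H N p =
      L * H ^ 3 / 12 - ∑ k ∈ Finset.range N, 16 * H ^ 4 / π ^ 5 *
        ((1 / (2 * (k : ℝ) + 1) ^ 5) * Real.tanh ((2 * (k : ℝ) + 1) * π * L / (2 * H))) := by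
  have hi : ∀ k : ℕ, IntegrableOn (fun p : ℝ × ℝ => cf L H k *
      (Real.cosh (fr H k * (p.1 - L / 2)) * Real.sin (fr H k * p.2)))
      (Set.Ioo 0 L ×ˢ Set.Ioo 0 H) := fun k => by
    refine integrableOn_rect (Continuous.continuousOn ?_)
    have : Continuous (fun p : ℝ × ℝ => Real.cosh (fr H k * (p.1 - L / 2))) :=
      Real.continuous_cosh.comp (by fun_prop)
    fun_prop
  have hi0 : IntegrableOn (fun p : ℝ × ℝ => p.2 * (H - p.2) / 2)
      (Set.Ioo 0 L ×ˢ Set.Ioo 0 H) :=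
    integrableOn_rect (Continuous.continuousOn (by fun_prop))
  simp only [wN]
  rw [integral_sub hi0 (integrable_finsetSum _ fun k _ => hi k),
    integral_finsetSum _ fun k _ => hi k]
  congr 1
  · have := setIntegral_prod_mul (μ := volume) (ν := volume) (fun _ : ℝ => (1 : ℝ)) (fun y : ℝ => y * (H - y) / 2)
      (Set.Ioo 0 L) (Set.Ioo 0 H)
    rw [int_poly hH] at this
    simp only [one_mul] at this
    rw [Measure.volume_eq_prod, this]
    simp [hL.le]
    ring
  · refine Finset.sum_congr rfl fun k _ => ?_
    rw [integral_const_mul, Measure.volume_eq_prod, setIntegral_prod_mul (fun x => Real.cosh (fr H k * (x - L / 2))) (fun y => Real.sin (fr H k * y)), int_sin hH, int_cosh hL hH,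
      show (2 * (k : ℝ) + 1) * π * L / (2 * H) = fr H k * (L / 2) by unfold fr; field_simp,
      Real.tanh_eq_sinh_div_cosh]
    unfold cf
    have := (Real.cosh_pos (fr H k * (L / 2))).ne'
    have h0 := (fr_pos hH k).ne'
    have h2 : (2 * (k : ℝ) + 1) = fr H k * H / π := by unfold fr; field_simp
    rw [h2]
    field_simp
    ring

lemma compare_wN (L H : ℝ) (hL : 0 < L) (hH : 0 < H) (u : ℝ × ℝ → ℝ)
    (hc : ContinuousOn u (Set.Icc 0 L ×ˢ Set.Icc 0 H))
    (hd : ContDiffOn ℝ 2 u (Set.Ioo (0 : ℝ) L ×ˢ Set.Ioo (0 : ℝ) H))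
    (hp : ∀ p ∈ Set.Ioo (0 : ℝ) L ×ˢ Set.Ioo (0 : ℝ) H,
      deriv (fun x : ℝ => deriv (fun x' : ℝ => u (x', p.2)) x) p.1 +
        deriv (fun y : ℝ => deriv (fun y' : ℝ => u (p.1, y')) y) p.2 = -1)
    (hb : ∀ p ∈ Set.Icc (0 : ℝ) L ×ˢ Set.Icc (0 : ℝ) H,
      p ∉ Set.Ioo (0 : ℝ) L ×ˢ Set.Ioo (0 : ℝ) H → u p = 0)
    (N : ℕ) (ε : ℝ)
    (hN : ∀ y ∈ Set.Icc 0 H, |y * (H - y) / 2 -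
      ∑ k ∈ Finset.range N, 4 / (H * fr H k ^ 3) * Real.sin (fr H k * y)| < ε)
    (p : ℝ × ℝ) (hpm : p ∈ Set.Icc (0 : ℝ) L ×ˢ Set.Icc (0 : ℝ) H) :
    |u p - wN L H N p| ≤ ε := by
  have hε : 0 < ε := (abs_nonneg _).trans_lt (hN 0 ⟨le_rfl, hH.le⟩)
  have hw := wN_contDiff L H N
  have hud : ∀ p ∈ Set.Ioo (0 : ℝ) L ×ˢ Set.Ioo (0 : ℝ) H, ContDiffAt ℝ 2 u p := fun p hp =>
    hd.contDiffAt ((isOpen_Ioo.prod isOpen_Ioo).mem_nhds hp)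
  have hwb : ∀ p ∈ Set.Icc (0 : ℝ) L ×ˢ Set.Icc (0 : ℝ) H,
      p ∉ Set.Ioo (0 : ℝ) L ×ˢ Set.Ioo (0 : ℝ) H → |wN L H N p| ≤ ε := by
    rintro ⟨x, y⟩ ⟨hx, hy⟩ hn
    simp only [] at hx hy
    have hcase : x = 0 ∨ x = L ∨ y = 0 ∨ y = H := by
      by_contra! hcon
      obtain ⟨a, b, c, d⟩ := hcon
      exact hn ⟨⟨lt_of_le_of_ne hx.1 a.symm, lt_of_le_of_ne hx.2 b⟩,
        ⟨lt_of_le_of_ne hy.1 c.symm, lt_of_le_of_ne hy.2 d⟩⟩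
    rcases hcase with rfl | rfl | rfl | rfl
    · rw [wN_x0]; exact (hN y hy).le
    · rw [wN_xL]; exact (hN y hy).le
    · rw [wN_y0]; simpa using hε.le
    · rw [wN_yH _ _ hH]; simpa using hε.le
  have hlap : ∀ p ∈ Set.Ioo (0 : ℝ) L ×ˢ Set.Ioo (0 : ℝ) H,
      deriv (fun x : ℝ => deriv (fun x' : ℝ => u (x', p.2) + -wN L H N (x', p.2)) x) p.1 +
        deriv (fun y : ℝ => deriv (fun y' : ℝ => u (p.1, y') + -wN L H N (p.1, y')) y) p.2 = 0 := by
    intro p hpi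
    have e1 := dd_add (sliceX (hud p hpi)) (sliceX hw.contDiffAt).neg
    have e2 := dd_add (sliceY (hud p hpi)) (sliceY hw.contDiffAt).neg
    rw [e1, e2]
    have f1 : deriv (fun t => deriv (fun x => -wN L H N (x, p.2)) t) p.1 =
        - deriv (fun x : ℝ => deriv (fun x' : ℝ => wN L H N (x', p.2)) x) p.1 := by
      simp only [deriv.fun_neg]
    have f2 : deriv (fun t => deriv (fun y => -wN L H N (p.1, y)) t) p.2 =
        - deriv (fun y : ℝ => deriv (fun y' : ℝ => wN L H N (p.1, y')) y) p.2 := by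
      simp only [deriv.fun_neg]
    rw [f1, f2, wN_xx, wN_yy]
    linarith [hp p hpi]
  have h1 := max_principle L H hL hH (fun p => u p + -wN L H N p) ε
    (hc.add hw.continuous.neg.continuousOn)
    (fun p hp => (hud p hp).add hw.contDiffAt.neg) hlap
    (fun p h h' => by rw [hb p h h']; linarith [abs_le.1 (hwb p h h')]) p hpm
  have h2 := max_principle L H hL hH (fun p => -(u p + -wN L H N p)) ε
    (hc.add hw.continuous.neg.continuousOn).neg
    (fun p hp => ((hud p hp).add hw.contDiffAt.neg).neg)
    (fun p hp => by
      have := hlap p hp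
      simp only [deriv.fun_neg]
      linarith)
    (fun p h h' => by rw [hb p h h']; linarith [abs_le.1 (hwb p h h')]) p hpm
  rw [abs_le]
  constructor <;> linarith

/-- Torsional rigidity of a rectangle: if `Ω = (0,L) × (0,H)` and `u` is continuous on the
closure of `Ω`, twice continuously differentiable on `Ω`, satisfies
`∂²u/∂x² + ∂²u/∂y² = −1` on `Ω` and vanishes on the boundary of `Ω`, then
`∫_Ω u = (4³H³L/π⁶)·(Z_r − (1/4)(πH/L)·∑_{k odd} (1/k⁵)·tanh(kπL/(2H)))` with
`Z_r = (1/12)·π⁶/2⁶`. -/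
theorem torsional_rigidity_rectangle (L H : ℝ) (hL : 0 < L) (hH : 0 < H)
    (Ω : Set (ℝ × ℝ)) (hΩ : Ω = Set.Ioo (0 : ℝ) L ×ˢ Set.Ioo (0 : ℝ) H)
    (u : ℝ × ℝ → ℝ)
    (hu_cont : ContinuousOn u (closure Ω))
    (hu_C2 : ContDiffOn ℝ 2 u Ω)
    (hu_pde : ∀ p ∈ Ω,
      deriv (fun x : ℝ => deriv (fun x' : ℝ => u (x', p.2)) x) p.1 +
        deriv (fun y : ℝ => deriv (fun y' : ℝ => u (p.1, y')) y) p.2 = -1)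
    (hu_bd : ∀ p ∈ frontier Ω, u p = 0) :
    ∫ p in Ω, u p =
      (4 ^ 3 * H ^ 3 * L / π ^ 6) *
        ((1 / 12) * π ^ 6 / 2 ^ 6 -
          (1 / 4) * (π * H / L) *
            ∑' k : ℕ, (1 / (2 * (k : ℝ) + 1) ^ 5) *
              Real.tanh ((2 * (k : ℝ) + 1) * π * L / (2 * H))) := by
  subst hΩ
  have hclos : closure (Set.Ioo (0 : ℝ) L ×ˢ Set.Ioo (0 : ℝ) H) =
      Set.Icc 0 L ×ˢ Set.Icc 0 H := by
    rw [closure_prod_eq, closure_Ioo hL.ne, closure_Ioo hH.ne]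
  rw [frontier, hclos, (isOpen_Ioo.prod isOpen_Ioo).interior_eq] at hu_bd
  rw [hclos] at hu_cont
  have hcmp := compare_wN L H hL hH u hu_cont hu_C2 hu_pde (fun p h h' => hu_bd p ⟨h, h'⟩)
  have hlim1 : Tendsto (fun N => ∫ p in Set.Ioo 0 L ×ˢ Set.Ioo 0 H, wN L H N p) atTop
      (𝓝 (∫ p in Set.Ioo 0 L ×ˢ Set.Ioo 0 H, u p)) := by
    rw [Metric.tendsto_nhds]
    intro ε hε
    have hε' : 0 < ε / (2 * (L * H)) := by positivity
    filter_upwards [bd_unif H hH _ hε'] with N hN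
    rw [dist_comm, dist_eq_norm, ← integral_sub (integrableOn_rect hu_cont)
      (integrableOn_rect (wN_contDiff L H N).continuous.continuousOn)]
    have hvol : (volume : Measure (ℝ × ℝ)) (Set.Ioo 0 L ×ˢ Set.Ioo 0 H) =
        ENNReal.ofReal (L * H) := by
      rw [Measure.volume_eq_prod, Measure.prod_prod, Real.volume_Ioo, Real.volume_Ioo,
        ENNReal.ofReal_mul hL.le]
      simp
    have := norm_setIntegral_le_of_norm_le_const (μ := volume)
      (s := Set.Ioo (0 : ℝ) L ×ˢ Set.Ioo (0 : ℝ) H) (f := fun p => u p - wN L H N p)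
      (C := ε / (2 * (L * H))) (by rw [hvol]; exact ENNReal.ofReal_lt_top)
      (fun p hp => hcmp N _ hN p
        (Set.prod_mono Set.Ioo_subset_Icc_self Set.Ioo_subset_Icc_self hp))
    refine this.trans_lt ?_
    rw [measureReal_def, hvol, ENNReal.toReal_ofReal (by positivity)]
    have : ε / (2 * (L * H)) * (L * H) = ε / 2 := by field_simp
    linarith
  have hsum : Summable fun k : ℕ => (1 / (2 * (k : ℝ) + 1) ^ 5) *
      Real.tanh ((2 * (k : ℝ) + 1) * π * L / (2 * H)) := by
    refine Summable.of_norm_bounded (summable_odd 5 (by norm_num)) fun k => ?_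
    rw [norm_mul, Real.norm_of_nonneg (by positivity)]
    exact mul_le_of_le_one_right (by positivity) (Real.abs_tanh_lt_one _).le
  have hlim2 := ((hsum.hasSum.mul_left (16 * H ^ 4 / π ^ 5)).tendsto_sum_nat).const_sub
    (L * H ^ 3 / 12)
  simp only [int_wN hL hH] at hlim1
  rw [tendsto_nhds_unique hlim1 hlim2]
  field_simp
  ring
end

section
/- The double series ∑_{j,k ≥ 1} 1/( j²k²(j² + k²) ) over all pairs of positive integers converges and equals ζ(4)ζ(2) + (1/2)ζ(6) − (π/2)·∑_{k=1}^∞ (1/k⁵)·coth(kπ). -/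
open Real

/-- Riemann zeta value at a positive integer `s > 1`, as the real Dirichlet series. -/
noncomputable def zetaR (s : ℕ) : ℝ := ∑' n : ℕ, 1 / ((n : ℝ) + 1) ^ s

lemma hasSum_change {E : Type*} [AddCommMonoid E] [TopologicalSpace E] {f g : ℕ → E} {a b : E}
    (h : HasSum f a) (hf : ∀ i, g i = f i) (hb : b = a) : HasSum g b := by
  have : g = f := funext hf
  rw [this, hb]
  exact h

lemma zetaR_hasSum (s : ℕ) (hs : 1 < s) :
    HasSum (fun n : ℕ => 1 / ((n : ℝ) + 1) ^ s) (zetaR s) := by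
  have h := (summable_nat_add_iff (f := fun n : ℕ => 1 / (n : ℝ) ^ s) 1).mpr
    (Real.summable_one_div_nat_pow.mpr hs)
  push_cast at h
  exact h.hasSum

lemma coth_hasSum (a : ℝ) (ha : 0 < a) :
    HasSum (fun j : ℕ => 1 / (((j : ℝ) + 1) ^ 2 + a ^ 2))
      (π / (2 * a) * coth (a * π) - 1 / (2 * a ^ 2)) := by
  have ha' : (a : ℂ) ≠ 0 := by exact_mod_cast ha.ne'
  have hz : (a * Complex.I : ℂ) ∈ Complex.integerComplement := by
    rintro ⟨n, hn⟩
    have := congrArg Complex.im hn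
    simp at this
    exact ha.ne this
  have h1 := cot_series_rep' hz
  have h2 : HasSum (fun n => cotTerm (a * Complex.I) n) _ := (summable_cotTerm hz).hasSum
  have h3 : ∑' n : ℕ, cotTerm (a * Complex.I) n
      = π * Complex.cot (π * (a * Complex.I)) - 1 / (a * Complex.I) := h1.symm
  rw [h3] at h2
  have h4 := h2.mul_left (Complex.I / (2 * a))
  rw [← Complex.hasSum_ofReal]
  have hs : Complex.sinh (a * π) ≠ 0 := by
    have : Real.sinh (a * π) ≠ 0 := (Real.sinh_pos_iff.mpr (by positivity)).ne'
    exact_mod_cast this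
  refine hasSum_change h4 (fun j => ?_) ?_
  · rw [cotTerm_identity hz]
    have h5 : ((j : ℂ) + 1) ^ 2 + (a : ℂ) ^ 2 ≠ 0 := by
      have : ((j : ℝ) + 1) ^ 2 + a ^ 2 ≠ 0 := by positivity
      exact_mod_cast this
    have h6 : ((a : ℂ) * Complex.I + (j + 1)) * (a * Complex.I - (j + 1))
        = -(((j : ℂ) + 1) ^ 2 + (a : ℂ) ^ 2) := by
      linear_combination (a : ℂ) ^ 2 * Complex.I_sq
    rw [h6]
    push_cast
    field_simp
    simp
  · have h7 : (π : ℂ) * (a * Complex.I) = (a * π) * Complex.I := by ring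
    rw [h7, Complex.cot, Complex.cos_mul_I, Complex.sin_mul_I, coth]
    push_cast
    have hI := Complex.I_ne_zero
    field_simp

theorem double_sum_all_pairs :
    HasSum
      (fun p : ℕ × ℕ =>
        1 / (((p.1 : ℝ) + 1) ^ 2 * ((p.2 : ℝ) + 1) ^ 2 *
          (((p.1 : ℝ) + 1) ^ 2 + ((p.2 : ℝ) + 1) ^ 2)))
      (zetaR 4 * zetaR 2 + (1 / 2) * zetaR 6 -
        (π / 2) * ∑' k : ℕ, (1 / ((k : ℝ) + 1) ^ 5) * coth (((k : ℝ) + 1) * π)) := by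
  have z2 := zetaR_hasSum 2 (by norm_num)
  have z4 := zetaR_hasSum 4 (by norm_num)
  have z6 := zetaR_hasSum 6 (by norm_num)
  have hsum : Summable (fun p : ℕ × ℕ =>
        1 / (((p.1 : ℝ) + 1) ^ 2 * ((p.2 : ℝ) + 1) ^ 2 *
          (((p.1 : ℝ) + 1) ^ 2 + ((p.2 : ℝ) + 1) ^ 2))) := by
    refine Summable.of_nonneg_of_le (fun p => by positivity) (fun p => ?_)
      (z2.summable.mul_of_nonneg z2.summable (fun n => by positivity) (fun n => by positivity))
    rw [one_div_mul_one_div]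
    apply one_div_le_one_div_of_le (by positivity)
    apply le_mul_of_one_le_right (by positivity)
    have h1 : (0 : ℝ) ≤ p.1 := by positivity
    nlinarith [sq_nonneg ((p.2 : ℝ) + 1)]
  have hfib : ∀ k : ℕ, HasSum (fun j : ℕ => 1 / (((k : ℝ) + 1) ^ 2 * ((j : ℝ) + 1) ^ 2 *
          (((k : ℝ) + 1) ^ 2 + ((j : ℝ) + 1) ^ 2)))
      (1 / ((k : ℝ) + 1) ^ 4 * zetaR 2 + (1 / 2) * (1 / ((k : ℝ) + 1) ^ 6)
        - (π / 2) * ((1 / ((k : ℝ) + 1) ^ 5) * coth (((k : ℝ) + 1) * π))) := by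
    intro k
    have hk : (0 : ℝ) < (k : ℝ) + 1 := by positivity
    have h := (z2.sub (coth_hasSum _ hk)).mul_left (1 / ((k : ℝ) + 1) ^ 4)
    refine hasSum_change h (fun j => ?_) ?_
    · have : ((j : ℝ) + 1) ≠ 0 := by positivity
      have : ((j : ℝ) + 1) ^ 2 + ((k : ℝ) + 1) ^ 2 ≠ 0 := by positivity
      have : ((k : ℝ) + 1) ^ 2 + ((j : ℝ) + 1) ^ 2 ≠ 0 := by positivity
      field_simp
      ring
    · field_simp
      ring
  have hg := hsum.hasSum.prod_fiberwise hfib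
  have hA := (z4.mul_right (zetaR 2)).add (z6.mul_left (1 / 2))
  have hC := (hA.sub hg).mul_left (2 / π)
  have hpi := Real.pi_ne_zero
  have hC' := hasSum_change
    (g := fun k : ℕ => (1 / ((k : ℝ) + 1) ^ 5) * coth (((k : ℝ) + 1) * π)) hC (fun k => by
    rw [sub_sub_cancel, ← mul_assoc]
    have : 2 / π * (π / 2) = 1 := by field_simp
    rw [this, one_mul]) rfl
  have := hsum.hasSum
  rw [hC'.tsum_eq]
  convert this using 1
  field_simp
  ring
end

section
/- The double series over all pairs (j,k) of positive integers of opposite parity (j + k odd) of 1/( j²k²(j² + k²) ) converges and equals Z_t − (π/2)·(1/2⁶)·∑_{k=1}^∞ (1/k⁵)·tanh(kπ) − (π/4)·∑_{k odd} (1/k⁵)·coth(kπ/2), where Z_t = (1/15)·π⁶/2⁶ and the last sum runs over odd positive integers k. -/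
open Real

lemma hs_congr {ι : Type} {f : ι → ℝ} {a : ℝ} (f' : ι → ℝ) {a' : ℝ} (h : HasSum f a)
    (hf : ∀ n, f' n = f n) (ha : a' = a) : HasSum f' a' := by
  rw [ha, show f' = f from funext hf]
  exact h

lemma bern_six : bernoulli 6 = 1/42 := by 
  rw [bernoulli_eq_bernoulli'_of_ne_one (by norm_num), bernoulli'_def]
  norm_num [Finset.sum_range_succ, Nat.choose]
  have : bernoulli' 5 = 0 := by 
    rw [bernoulli'_def]
    norm_num [Finset.sum_range_succ, Nat.choose]
  rw [this]; norm_num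
lemma coth_sum (a : ℝ) (ha : 0 < a) : HasSum (fun n : ℕ => 1/(((n:ℝ)+1)^2+a^2)) (π/(2*a) * (cosh (π*a)/sinh (π*a)) - 1/(2*a^2)) := by
  have hs : Summable (fun n : ℕ => 1/(((n:ℝ)+1)^2+a^2)) := by
    have h0 : Summable (fun n : ℕ => 1/((n:ℝ)+1)^2) := by
      have := (summable_nat_add_iff 1).2 (Real.summable_one_div_nat_pow (p := 2) |>.2 (by norm_num))
      simpa using this
    refine Summable.of_nonneg_of_le (fun n => by positivity) (fun n => ?_) h0
    apply one_div_le_one_div_of_le (by positivity)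
    nlinarith [sq_nonneg a]
  have hx : (Complex.I * a) ∈ Complex.integerComplement := by
    rw [Complex.mem_integerComplement_iff]
    rintro ⟨n, hn⟩
    have := congrArg Complex.im hn
    simp at this
    exact ha.ne this
  have h := cot_series_rep' hx
  have ha' : (a:ℂ) ≠ 0 := by exact_mod_cast ha.ne'
  have hsh : (Real.sinh (π*a)) ≠ 0 := by
    rw [Ne, Real.sinh_eq_zero]; positivity
  have hsh' : (Complex.sinh (π*a)) ≠ 0 := by
    exact_mod_cast hsh
  have e1 : ∀ n : ℕ, (1 / (Complex.I * a - (n + 1)) + 1 / (Complex.I * a + (n + 1)) : ℂ) = (-2 * Complex.I * a) * (((1/(((n:ℝ)+1)^2+a^2) : ℝ)) : ℂ) := by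
    intro n
    have q1 : (Complex.I * a - (n + 1) : ℂ) ≠ 0 := by
      intro hh
      have := congrArg Complex.im hh
      simp at this
      exact ha.ne' this
    have q2 : (Complex.I * a + (n + 1) : ℂ) ≠ 0 := by
      intro hh
      have := congrArg Complex.im hh
      simp at this
      exact ha.ne' this
    have q3 : (((n:ℂ)+1)^2+(a:ℂ)^2) ≠ 0 := by
      have : (((n:ℝ)+1)^2+a^2) ≠ 0 := by positivity
      exact_mod_cast this
    push_cast
    field_simp
    ring_nf
    simp [mul_assoc]
  rw [tsum_congr e1, tsum_mul_left, ← Complex.ofReal_tsum] at h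
  rw [hs.hasSum_iff]
  rw [Complex.cot_eq_cos_div_sin, show (π * (Complex.I * a) : ℂ) = (π * a) * Complex.I by ring, Complex.cos_mul_I, Complex.sin_mul_I] at h
  have : ((∑' n : ℕ, 1/(((n:ℝ)+1)^2+a^2) : ℝ) : ℂ) = ((π/(2*a) * (cosh (π*a)/sinh (π*a)) - 1/(2*a^2) : ℝ) : ℂ) := by
    generalize (∑' n : ℕ, 1/(((n:ℝ)+1)^2+a^2) : ℝ) = T at *
    push_cast
    field_simp at h ⊢
    linear_combination (-1:ℂ) * h + (2 * (a:ℂ)^2 * Complex.sinh (π*a) * T) * Complex.I_sq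
  exact_mod_cast this

lemma zeta_six : HasSum (fun n : ℕ => 1 / (n:ℝ)^6) (π^6/945) := by
  have h := hasSum_zeta_nat (k := 3) (by norm_num)
  norm_num [bern_six, Nat.factorial] at h ⊢
  convert h using 1
  ring

lemma odd_of_all {f : ℕ → ℝ} {Z E : ℝ} (h : HasSum f Z) (hE : HasSum (fun n => f (2*n)) E) :
    HasSum (fun n => f (2*n+1)) (Z - E) := by
  have hs : Summable (fun n => f (2*n+1)) :=
    h.summable.comp_injective (i := fun n : ℕ => 2*n+1) (fun a b hab => by simpa using hab)
  have h2 := (hE.even_add_odd hs.hasSum).unique h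
  rw [hs.hasSum_iff]
  linarith

lemma odd_zeta {k : ℕ} {Z : ℝ} (h : HasSum (fun n : ℕ => 1 / (n:ℝ)^k) Z) :
    HasSum (fun n : ℕ => 1 / (2*(n:ℝ)+1)^k) (Z - Z/2^k) := by
  have := odd_of_all h (E := Z/2^k) (by
    have := h.div_const (2^k)
    refine this.congr_fun ?_ |> fun h => h
    intro n
    push_cast
    rw [mul_pow, div_div, mul_comm])
  simpa using this

lemma succ_zeta {k : ℕ} (hk : k ≠ 0) {Z : ℝ} (h : HasSum (fun n : ℕ => 1 / (n:ℝ)^k) Z) :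
    HasSum (fun n : ℕ => 1 / ((n:ℝ)+1)^k) Z := by
  have := (hasSum_nat_add_iff (f := fun n : ℕ => 1 / (n:ℝ)^k) (g := Z) 1).2 (by simpa [hk] using h)
  simpa using this

/-- sum over even indices -/
lemma even_sum (k : ℝ) (hk : 0 < k) : HasSum (fun m : ℕ => 1/((2*((m:ℝ)+1))^2+k^2))
    (π/(4*k) * coth (k*π/2) - 1/(2*k^2)) := by
  have h := (coth_sum (k/2) (by positivity)).div_const 4
  refine hs_congr _ h ?_ ?_
  · intro m
    rw [div_div]
    congr 1
    ring
  · rw [coth, show π * (k/2) = k*π/2 by ring]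
    field_simp
    ring

lemma odd_sum (k : ℝ) (hk : 0 < k) : HasSum (fun m : ℕ => 1/((2*(m:ℝ)+1)^2+k^2))
    (π/(4*k) * tanh (k*π/2)) := by
  have h1 : HasSum (fun n : ℕ => 1/((n:ℝ)^2+k^2)) (π/(2*k) * coth (π*k) - 1/(2*k^2) + 1/k^2) := by
    have := (hasSum_nat_add_iff (f := fun n : ℕ => 1 / ((n:ℝ)^2+k^2)) (g := π/(2*k) * coth (π*k) - 1/(2*k^2)) 1).1
      (by simpa [coth] using coth_sum k hk)
    simpa using this
  have h2 : HasSum (fun n : ℕ => 1/(((2*n:ℕ):ℝ)^2+k^2)) (π/(4*k) * coth (k*π/2) - 1/(2*k^2) + 1/k^2) := by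
    have := (hasSum_nat_add_iff (f := fun n : ℕ => 1 / (((2*n:ℕ):ℝ)^2+k^2)) (g := π/(4*k) * coth (k*π/2) - 1/(2*k^2)) 1).1
      (by simpa using even_sum k hk)
    simpa using this
  have h3 := odd_of_all h1 h2
  convert h3 using 1
  · ext m; push_cast; rfl
  · have hs : sinh (k*π/2) ≠ 0 := by
      rw [Ne, Real.sinh_eq_zero]; positivity
    have hc : cosh (k*π/2) ≠ 0 := (Real.cosh_pos _).ne'
    rw [coth, coth, Real.tanh_eq_sinh_div_cosh, show π*k = 2*(k*π/2) by ring, Real.sinh_two_mul, Real.cosh_two_mul]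
    field_simp
    ring

noncomputable def F (x y : ℝ) : ℝ := 1 / (x^2 * y^2 * (x^2+y^2))

lemma F_comm (x y : ℝ) : F x y = F y x := by unfold F; congr 1; ring

lemma F_eq (x y : ℝ) (hx : 0 < x) (hy : 0 < y) :
    F x y = 1/x^4 * (1/y^2) - 1/x^4 * (1/(y^2+x^2)) := by
  unfold F; field_simp; ring

lemma F_summable : Summable (fun p : ℕ × ℕ => F (2*(p.1:ℝ)+1) (2*((p.2:ℝ)+1))) := by
  have h := (odd_zeta hasSum_zeta_two).summable.mul_of_nonneg
    (succ_zeta (by norm_num) hasSum_zeta_two).summable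
    (fun n => by positivity) (fun n => by positivity)
  refine Summable.of_nonneg_of_le (fun p => by unfold F; positivity) (fun p => ?_) h
  unfold F
  rw [← one_div_mul_one_div, ← one_div_mul_one_div]
  have a1 : (0:ℝ) ≤ p.1 := by positivity
  have a2 : (0:ℝ) ≤ p.2 := by positivity
  have q1 : 1/(2*((p.2:ℝ)+1))^2 ≤ 1/((p.2:ℝ)+1)^2 := by
    apply one_div_le_one_div_of_le (by positivity); nlinarith
  have q2 : 1/((2*(p.1:ℝ)+1)^2+(2*((p.2:ℝ)+1))^2) ≤ 1 := by
    rw [div_le_one (by positivity)]; nlinarith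
  calc _ ≤ 1/(2*(p.1:ℝ)+1)^2 * (1/((p.2:ℝ)+1)^2) * 1 := by gcongr
    _ = _ := by ring

lemma side1 {S : ℝ} (h : HasSum (fun p : ℕ × ℕ => F (2*(p.1:ℝ)+1) (2*((p.2:ℝ)+1))) S) :
    S = π^6/2304 + π^6/1920 - (π / 4) *
          ∑' k : ℕ, (1 / (2 * (k : ℝ) + 1) ^ 5) * coth ((2 * (k : ℝ) + 1) * π / 2) := by
  have hz : HasSum (fun m : ℕ => 1/(2*((m:ℝ)+1))^2) (π^2/24) := by
    have := (succ_zeta (by norm_num) hasSum_zeta_two).div_const 4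
    refine hs_congr _ this ?_ ?_
    · intro m; rw [div_div]; congr 1; ring
    · ring
  have h1 := h.prod_fiberwise (g := fun n : ℕ => 1/(2*(n:ℝ)+1)^4 * (π^2/24) - 1/(2*(n:ℝ)+1)^4 *
      (π/(4*(2*(n:ℝ)+1)) * coth ((2*(n:ℝ)+1)*π/2) - 1/(2*(2*(n:ℝ)+1)^2))) (by
    intro n
    have hn : (0:ℝ) < 2*(n:ℝ)+1 := by positivity
    have := (hz.mul_left (1/(2*(n:ℝ)+1)^4)).sub ((even_sum _ hn).mul_left (1/(2*(n:ℝ)+1)^4))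
    refine hs_congr _ this ?_ rfl
    intro m
    exact F_eq _ _ hn (by positivity))
  have h4 := (odd_zeta hasSum_zeta_four).mul_right (π^2/24)
  have h6 := (odd_zeta zeta_six).mul_right (1/2)
  have h7 := ((h4.add h6).sub h1).mul_left (4/π)
  have h8 := hs_congr (fun k : ℕ => (1 / (2 * (k : ℝ) + 1) ^ 5) * coth ((2 * (k : ℝ) + 1) * π / 2)) h7 (by
    intro n
    have hn : (0:ℝ) < 2*(n:ℝ)+1 := by positivity
    generalize coth ((2*(n:ℝ)+1)*π/2) = c
    generalize 2*(n:ℝ)+1 = x at *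
    have := Real.pi_ne_zero
    field_simp
    ring
    ) rfl
  rw [h8.tsum_eq]
  field_simp
  ring

lemma side2 {S : ℝ} (h : HasSum (fun p : ℕ × ℕ => F (2*(p.1:ℝ)+1) (2*((p.2:ℝ)+1))) S) :
    S = π^6/11520 - (π / 2) * (1 / 2 ^ 6) *
          ∑' k : ℕ, (1 / ((k : ℝ) + 1) ^ 5) * Real.tanh (((k : ℝ) + 1) * π) := by
  have hz := odd_zeta hasSum_zeta_two
  have h' : HasSum (fun p : ℕ × ℕ => F (2*((p.1:ℝ)+1)) (2*(p.2:ℝ)+1)) S := by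
    have := (Equiv.prodComm ℕ ℕ).hasSum_iff.2 h
    convert this using 1
    ext p
    exact F_comm _ _
  have h1 := h'.prod_fiberwise (g := fun n : ℕ => 1/(2*((n:ℝ)+1))^4 * (π^2/6 - π^2/6/2^2) - 1/(2*((n:ℝ)+1))^4 *
      (π/(4*(2*((n:ℝ)+1))) * tanh ((2*((n:ℝ)+1))*π/2))) (by
    intro n
    have hn : (0:ℝ) < 2*((n:ℝ)+1) := by positivity
    have := (hz.mul_left (1/(2*((n:ℝ)+1))^4)).sub ((odd_sum _ hn).mul_left (1/(2*((n:ℝ)+1))^4))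
    refine hs_congr _ this ?_ rfl
    intro m
    exact F_eq _ _ hn (by positivity))
  have h4 := (succ_zeta (by norm_num) hasSum_zeta_four).mul_right (π^2/128)
  have h7 := (h4.sub h1).mul_left (128/π)
  have h8 := hs_congr (fun k : ℕ => (1 / ((k : ℝ) + 1) ^ 5) * Real.tanh (((k : ℝ) + 1) * π)) h7 (by
    intro n
    have hn : (0:ℝ) < (n:ℝ)+1 := by positivity
    rw [show 2*((n:ℝ)+1)*π/2 = ((n:ℝ)+1)*π by ring]
    generalize tanh (((n:ℝ)+1)*π) = c
    generalize (n:ℝ)+1 = x at *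
    have := Real.pi_ne_zero
    field_simp
    ring
    ) rfl
  rw [h8.tsum_eq]
  field_simp
  ring

def toPair : (ℕ × ℕ) ⊕ (ℕ × ℕ) → {p : ℕ × ℕ // 0 < p.1 ∧ 0 < p.2 ∧ Odd (p.1 + p.2)}
  | Sum.inl p => ⟨(2*p.1+1, 2*(p.2+1)), by simp, by simp, by simp; grind⟩
  | Sum.inr p => ⟨(2*(p.2+1), 2*p.1+1), by simp, by simp, by simp; grind⟩

lemma toPair_bij : Function.Bijective toPair := by
  constructor
  · rintro (⟨a, b⟩ | ⟨a, b⟩) (⟨c, d⟩ | ⟨c, d⟩) h <;> simp [toPair] at h ⊢ <;> omega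
  · rintro ⟨⟨j, k⟩, hj, hk, ho⟩
    simp only at hj hk ho
    rcases Nat.even_or_odd' j with ⟨a, rfl | rfl⟩ <;> rcases Nat.even_or_odd' k with ⟨b, rfl | rfl⟩
    · exact absurd ho (by rw [Nat.odd_iff]; omega)
    · refine ⟨Sum.inr (b, a-1), ?_⟩
      simp [toPair]; omega
    · refine ⟨Sum.inl (a, b-1), ?_⟩
      simp [toPair]; omega
    · exact absurd ho (by rw [Nat.odd_iff]; omega)

/-- The double series over pairs `(j,k)` of positive integers of opposite parity of
`1/(j²k²(j² + k²))` converges and equals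
`Z_t − (π/2)(1/2⁶)∑_{k≥1}(1/k⁵)tanh(kπ) − (π/4)∑_{k odd}(1/k⁵)coth(kπ/2)`,
where `Z_t = (1/15)·π⁶/2⁶`. -/
theorem double_sum_opposite_parity :
    HasSum
      (fun p : {p : ℕ × ℕ // 0 < p.1 ∧ 0 < p.2 ∧ Odd (p.1 + p.2)} =>
        1 / (((p.val.1 : ℝ)) ^ 2 * ((p.val.2 : ℝ)) ^ 2 *
          (((p.val.1 : ℝ)) ^ 2 + ((p.val.2 : ℝ)) ^ 2)))
      ((1 / 15) * π ^ 6 / 2 ^ 6 -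
        (π / 2) * (1 / 2 ^ 6) *
          ∑' k : ℕ, (1 / ((k : ℝ) + 1) ^ 5) * Real.tanh (((k : ℝ) + 1) * π) -
        (π / 4) *
          ∑' k : ℕ, (1 / (2 * (k : ℝ) + 1) ^ 5) * coth ((2 * (k : ℝ) + 1) * π / 2)) := by
  have hS := F_summable.hasSum
  have e1 := side1 hS
  have e2 := side2 hS
  rw [← (Equiv.ofBijective toPair toPair_bij).hasSum_iff]
  have h := HasSum.sum (f := (fun p : {p : ℕ × ℕ // 0 < p.1 ∧ 0 < p.2 ∧ Odd (p.1 + p.2)} =>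
        1 / (((p.val.1 : ℝ)) ^ 2 * ((p.val.2 : ℝ)) ^ 2 *
          (((p.val.1 : ℝ)) ^ 2 + ((p.val.2 : ℝ)) ^ 2))) ∘ (Equiv.ofBijective toPair toPair_bij))
      (a := ∑' p : ℕ × ℕ, F (2*(p.1:ℝ)+1) (2*((p.2:ℝ)+1)))
      (b := ∑' p : ℕ × ℕ, F (2*(p.1:ℝ)+1) (2*((p.2:ℝ)+1)))
      (by
        convert hS using 1
        ext p
        simp [toPair, F])
      (by
        convert hS using 1
        ext p
        rw [F_comm]
        simp [toPair, F])
  convert h using 1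
  rw [sub_eq_iff_eq_add] at *
  linarith
end

section
/- For every real number t, the number of pairs of positive integers (j,k) with j² + k² = t plus the number of pairs of positive integers (j,k) with j < k and j² + k² = 4t equals the number of pairs of positive integers (j,k) with j² + 4k² = 4t plus the number of pairs of positive integers (j,k) with j < k and j² + k² = 2t. Equivalently, the multiset of Dirichlet eigenvalues { π²(j² + k²) : j,k ≥ 1 } ⊎ { π²(j² + k²)/4 : 1 ≤ j < k } of the Chapman domain C₁ coincides with the multiset { π²(j²/4 + k²) : j,k ≥ 1 } ⊎ { π²(j² + k²)/2 : 1 ≤ j < k } of the Chapman domain C₂. -/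
theorem chapman_fin (n : ℕ) (S : Set (ℕ × ℕ))
    (h : ∀ p ∈ S, p.1 ^ 2 + p.2 ^ 2 ≤ n) : S.Finite := by
  apply ((Set.finite_Iic n).prod (Set.finite_Iic n)).subset
  intro p hp
  have := h p hp
  simp only [Set.mem_prod, Set.mem_Iic]
  constructor <;> nlinarith [Nat.le_self_pow (n := 2) (by norm_num) p.1,
    Nat.le_self_pow (n := 2) (by norm_num) p.2]

theorem chapman_nat (n : ℕ) :
    ({p : ℕ × ℕ | 0 < p.1 ∧ 0 < p.2 ∧ 4 * (p.1 ^ 2 + p.2 ^ 2) = n}.ncard +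
      {p : ℕ × ℕ | 0 < p.1 ∧ 0 < p.2 ∧ p.1 < p.2 ∧ p.1 ^ 2 + p.2 ^ 2 = n}.ncard) =
    ({p : ℕ × ℕ | 0 < p.1 ∧ 0 < p.2 ∧ p.1 ^ 2 + 4 * p.2 ^ 2 = n}.ncard +
      {p : ℕ × ℕ | 0 < p.1 ∧ 0 < p.2 ∧ p.1 < p.2 ∧ 2 * (p.1 ^ 2 + p.2 ^ 2) = n}.ncard) := by
  set A := {p : ℕ × ℕ | 0 < p.1 ∧ 0 < p.2 ∧ 4 * (p.1 ^ 2 + p.2 ^ 2) = n} with hA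
  set B := {p : ℕ × ℕ | 0 < p.1 ∧ 0 < p.2 ∧ p.1 < p.2 ∧ p.1 ^ 2 + p.2 ^ 2 = n} with hB
  set C := {p : ℕ × ℕ | 0 < p.1 ∧ 0 < p.2 ∧ p.1 ^ 2 + 4 * p.2 ^ 2 = n} with hC
  set D := {p : ℕ × ℕ | 0 < p.1 ∧ 0 < p.2 ∧ p.1 < p.2 ∧ 2 * (p.1 ^ 2 + p.2 ^ 2) = n} with hD
  have fB : B.Finite := chapman_fin n B (by rintro p ⟨_, _, _, h⟩; omega)
  have fC : C.Finite := chapman_fin n C (by rintro p ⟨_, _, h⟩; omega)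
  have eB := Set.ncard_inter_add_ncard_sdiff_eq_ncard B {p | p.1 % 2 = p.2 % 2} fB
  have eC := Set.ncard_inter_add_ncard_sdiff_eq_ncard C {p | p.1 % 2 = 0} fC
  -- both coordinates doubled
  have h1 : A.ncard = (C ∩ {p | p.1 % 2 = 0}).ncard := by
    refine Set.ncard_congr (fun p _ => (2 * p.1, p.2)) ?_ ?_ ?_
    · rintro ⟨a, b⟩ ⟨h1, h2, h3⟩
      refine ⟨⟨by simpa using h1, h2, ?_⟩, by simp⟩
      simp only at h3 ⊢
      rw [← h3]; ring
    · rintro ⟨a, b⟩ ⟨c, d⟩ _ _ h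
      simp only [Prod.mk.injEq] at h ⊢
      omega
    · rintro ⟨a, b⟩ ⟨⟨h1, h2, h3⟩, h4⟩
      simp only [Set.mem_setOf_eq] at h1 h2 h3 h4
      obtain ⟨c, rfl⟩ := Nat.dvd_of_mod_eq_zero h4
      refine ⟨(c, b), ⟨by simp only; omega, h2, ?_⟩, rfl⟩
      simp only
      rw [← h3]; ring
  -- the rotation by 45 degrees
  have h2 : D.ncard = (B ∩ {p | p.1 % 2 = p.2 % 2}).ncard := by
    refine Set.ncard_congr (fun p _ => (p.2 - p.1, p.2 + p.1)) ?_ ?_ ?_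
    · rintro ⟨a, b⟩ ⟨h1, h2, h3, h4⟩
      simp only at h1 h2 h3 h4
      obtain ⟨c, rfl⟩ := Nat.exists_eq_add_of_lt h3
      have e : a + c + 1 - a = c + 1 := by omega
      refine ⟨⟨?_, ?_, ?_, ?_⟩, ?_⟩ <;> simp only [Set.mem_setOf_eq, e]
      · omega
      · omega
      · omega
      · rw [← h4]; ring
      · omega
    · rintro ⟨a, b⟩ ⟨c, d⟩ ⟨_, _, h3, _⟩ ⟨_, _, h3', _⟩ h
      simp only [Prod.mk.injEq] at h h3 h3' ⊢
      omega
    · rintro ⟨a, b⟩ ⟨⟨h1, h2, h3, h4⟩, h5⟩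
      simp only [Set.mem_setOf_eq] at h1 h2 h3 h4 h5
      obtain ⟨c, rfl⟩ : ∃ c, b = a + 2 * c := ⟨(b - a) / 2, by omega⟩
      refine ⟨(c, a + c), ⟨?_, ?_, ?_, ?_⟩, ?_⟩ <;> simp only [Prod.mk.injEq]
      · omega
      · omega
      · omega
      · rw [← h4]; ring
      · omega
  -- sorting the odd and the even coordinate
  have h3 : (C \ {p | p.1 % 2 = 0}).ncard = (B \ {p | p.1 % 2 = p.2 % 2}).ncard := by
    refine Set.ncard_congr (fun p _ => (min p.1 (2 * p.2), max p.1 (2 * p.2))) ?_ ?_ ?_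
    · rintro ⟨a, b⟩ ⟨⟨h1, h2, h3⟩, h4⟩
      simp only [Set.mem_setOf_eq] at h1 h2 h3 h4
      refine ⟨⟨?_, ?_, ?_, ?_⟩, ?_⟩ <;> simp only [Set.mem_setOf_eq]
      · omega
      · omega
      · omega
      · rcases le_total a (2 * b) with h | h
        · rw [min_eq_left h, max_eq_right h, ← h3]; ring
        · rw [min_eq_right h, max_eq_left h, ← h3]; ring
      · omega
    · rintro ⟨a, b⟩ ⟨c, d⟩ ⟨_, h⟩ ⟨_, h'⟩ e
      simp only [Prod.mk.injEq, Set.mem_setOf_eq] at h h' e ⊢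
      omega
    · rintro ⟨a, b⟩ ⟨⟨h1, h2, h3, h4⟩, h5⟩
      simp only [Set.mem_setOf_eq] at h1 h2 h3 h4 h5
      rcases Nat.mod_two_eq_zero_or_one a with h | h
      · obtain ⟨c, rfl⟩ := Nat.dvd_of_mod_eq_zero h
        refine ⟨(b, c), ⟨⟨h2, by simp only; omega, ?_⟩, ?_⟩, ?_⟩ <;>
          simp only [Set.mem_setOf_eq, Prod.mk.injEq]
        · rw [← h4]; ring
        · omega
        · omega
      · obtain ⟨c, rfl⟩ : ∃ c, b = 2 * c := ⟨b / 2, by omega⟩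
        refine ⟨(a, c), ⟨⟨h1, by simp only; omega, ?_⟩, ?_⟩, ?_⟩ <;>
          simp only [Set.mem_setOf_eq, Prod.mk.injEq]
        · rw [← h4]; ring
        · omega
        · omega
  omega

/-- Isospectrality of the Chapman domains, expressed via eigenvalue-counting:
for every real `t`, the number of pairs of positive integers `(j,k)` with `j² + k² = t`
plus the number of pairs of positive integers `(j,k)` with `j < k` and `j² + k² = 4t`
equals the number of pairs of positive integers `(j,k)` with `j² + 4k² = 4t`
plus the number of pairs of positive integers `(j,k)` with `j < k` and `j² + k² = 2t`. -/
theorem chapman_isospectral (t : ℝ) :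
    ({p : ℕ × ℕ | 0 < p.1 ∧ 0 < p.2 ∧ ((p.1 : ℝ) ^ 2 + (p.2 : ℝ) ^ 2 = t)}.ncard +
      {p : ℕ × ℕ | 0 < p.1 ∧ 0 < p.2 ∧ p.1 < p.2 ∧
        ((p.1 : ℝ) ^ 2 + (p.2 : ℝ) ^ 2 = 4 * t)}.ncard) =
    ({p : ℕ × ℕ | 0 < p.1 ∧ 0 < p.2 ∧ ((p.1 : ℝ) ^ 2 + 4 * (p.2 : ℝ) ^ 2 = 4 * t)}.ncard +
      {p : ℕ × ℕ | 0 < p.1 ∧ 0 < p.2 ∧ p.1 < p.2 ∧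
        ((p.1 : ℝ) ^ 2 + (p.2 : ℝ) ^ 2 = 2 * t)}.ncard) := by
  by_cases ht : ∃ n : ℕ, 4 * t = n
  · obtain ⟨n, hn⟩ := ht
    have h := chapman_nat n
    have e1 : ∀ a b : ℕ, (a : ℝ) ^ 2 + (b : ℝ) ^ 2 = t ↔ 4 * (a ^ 2 + b ^ 2) = n := by
      intro a b
      rw [← Nat.cast_inj (R := ℝ), ← hn]
      push_cast
      constructor <;> intro h <;> linarith
    have e2 : ∀ a b : ℕ, (a : ℝ) ^ 2 + (b : ℝ) ^ 2 = 4 * t ↔ a ^ 2 + b ^ 2 = n := by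
      intro a b
      rw [← Nat.cast_inj (R := ℝ), ← hn]
      push_cast
      rfl
    have e3 : ∀ a b : ℕ, (a : ℝ) ^ 2 + 4 * (b : ℝ) ^ 2 = 4 * t ↔ a ^ 2 + 4 * b ^ 2 = n := by
      intro a b
      rw [← Nat.cast_inj (R := ℝ), ← hn]
      push_cast
      rfl
    have e4 : ∀ a b : ℕ, (a : ℝ) ^ 2 + (b : ℝ) ^ 2 = 2 * t ↔ 2 * (a ^ 2 + b ^ 2) = n := by
      intro a b
      rw [← Nat.cast_inj (R := ℝ), ← hn]
      push_cast
      constructor <;> intro h <;> linarith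
    simp only [e1, e2, e3, e4]
    exact h
  · have e1 : ∀ a b : ℕ, ¬ ((a : ℝ) ^ 2 + (b : ℝ) ^ 2 = t) := fun a b h =>
      ht ⟨4 * (a ^ 2 + b ^ 2), by push_cast; linarith⟩
    have e2 : ∀ a b : ℕ, ¬ ((a : ℝ) ^ 2 + (b : ℝ) ^ 2 = 4 * t) := fun a b h =>
      ht ⟨a ^ 2 + b ^ 2, by push_cast; linarith⟩
    have e3 : ∀ a b : ℕ, ¬ ((a : ℝ) ^ 2 + 4 * (b : ℝ) ^ 2 = 4 * t) := fun a b h =>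
      ht ⟨a ^ 2 + 4 * b ^ 2, by push_cast; linarith⟩
    have e4 : ∀ a b : ℕ, ¬ ((a : ℝ) ^ 2 + (b : ℝ) ^ 2 = 2 * t) := fun a b h =>
      ht ⟨2 * (a ^ 2 + b ^ 2), by push_cast; linarith⟩
    simp only [e1, e2, e3, e4, and_false]
end
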